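/- Under the asymptotic one-shot random-canary setup, the rescaled empirical variance of the canary cosines satisfies d · σ̂_d² → 1 in probability as d → ∞, where σ̂_d² = (1/k) Σ_{i=1}^k (g_{di} − μ̂_d)² with g_{di} = ⟨c_{di}, ρ_d⟩/‖ρ_d‖ and μ̂_d = (1/k) Σ_{i=1}^k g_{di}. -/

import Mathlib

open MeasureTheory ProbabilityTheory Real Filter
open scoped InnerProductSpace Topology ENNReal

/-- The standard Gaussian measure `N(0, I_d)` on `ℝ^d`, obtained by mapping the product
of `d` independent one-dimensional standard Gaussians onto `EuclideanSpace ℝ (Fin d)`. -/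
noncomputable def stdGaussianE (d : ℕ) : Measure (EuclideanSpace ℝ (Fin d)) :=
  Measure.map (⇑(EuclideanSpace.equiv (Fin d) ℝ).symm)
    (Measure.pi fun _ : Fin d => gaussianReal 0 1)

/-- The joint distribution of `k` i.i.d. canaries `c_1, …, c_k` drawn from the
(uniform) measure `μs` on the unit sphere, together with an independent standard
Gaussian vector `Z ∼ N(0, I_d)`.  A sample point is `ω = ((c_1, …, c_k), Z)`. -/
noncomputable def canaryP (d k : ℕ) (μs : Measure (EuclideanSpace ℝ (Fin d))) :
    Measure ((Fin k → EuclideanSpace ℝ (Fin d)) × EuclideanSpace ℝ (Fin d)) :=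
  (Measure.pi fun _ : Fin k => μs).prod (stdGaussianE d)

/-- The mechanism output `ρ = X + ∑_{i=1}^k c_i + σ Z`. -/
noncomputable def rhoF (d k : ℕ) (X : EuclideanSpace ℝ (Fin d)) (σ : ℝ)
    (ω : (Fin k → EuclideanSpace ℝ (Fin d)) × EuclideanSpace ℝ (Fin d)) :
    EuclideanSpace ℝ (Fin d) :=
  X + (∑ i, ω.1 i) + σ • ω.2

/-- The cosine statistic `g_i = ⟪c_i, ρ⟫ / ‖ρ‖` of the `i`-th canary. -/
noncomputable def cosStat (d k : ℕ) (X : EuclideanSpace ℝ (Fin d)) (σ : ℝ)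
    (ω : (Fin k → EuclideanSpace ℝ (Fin d)) × EuclideanSpace ℝ (Fin d)) (i : Fin k) : ℝ :=
  ⟪ω.1 i, rhoF d k X σ ω⟫_ℝ / ‖rhoF d k X σ ω‖

/-- The empirical mean `μ̂ = (1/k) ∑ᵢ g_i` of the canary cosines. -/
noncomputable def muHat (d k : ℕ) (X : EuclideanSpace ℝ (Fin d)) (σ : ℝ)
    (ω : (Fin k → EuclideanSpace ℝ (Fin d)) × EuclideanSpace ℝ (Fin d)) : ℝ :=
  (1 / k : ℝ) * ∑ i, cosStat d k X σ ω i

/-- The empirical variance `σ̂² = (1/k) ∑ᵢ (g_i - μ̂)²` of the canary cosines. -/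
noncomputable def sigmaHatSq (d k : ℕ) (X : EuclideanSpace ℝ (Fin d)) (σ : ℝ)
    (ω : (Fin k → EuclideanSpace ℝ (Fin d)) × EuclideanSpace ℝ (Fin d)) : ℝ :=
  (1 / k : ℝ) * ∑ i, (cosStat d k X σ ω i - muHat d k X σ ω) ^ 2


lemma lint_var_pi {Ω : Type*} [MeasurableSpace Ω] (ν : Measure Ω) [IsProbabilityMeasure ν]
    (n : ℕ) (f : Fin n → Ω → ℝ) (hf : ∀ i, MemLp (f i) 2 ν) :
    ∫⁻ ω, ENNReal.ofReal ((∑ i, f i (ω i) - ∑ i, ∫ x, f i x ∂ν) ^ 2) ∂(Measure.pi fun _ : Fin n => ν)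
      ≤ ∑ i, ∫⁻ x, ENNReal.ofReal (f i x ^ 2) ∂ν := by
  have hf' : ∀ i, MemLp (fun ω : Fin n → Ω => f i (ω i)) 2 (Measure.pi fun _ : Fin n => ν) :=
    fun i => (hf i).comp_measurePreserving (measurePreserving_eval (fun _ : Fin n => ν) i)
  have hm : ∫ ω, (∑ i, fun ω : Fin n → Ω => f i (ω i)) ω ∂(Measure.pi fun _ : Fin n => ν)
      = ∑ i, ∫ x, f i x ∂ν := by
    simp only [Finset.sum_apply]
    rw [integral_finsetSum _ (fun i _ => (hf' i).integrable (by norm_num))]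
    refine Finset.sum_congr rfl fun i _ => ?_
    have hmp := measurePreserving_eval (fun _ : Fin n => ν) i
    have := integral_map (μ := Measure.pi fun _ : Fin n => ν) (φ := Function.eval i) (f := f i)
      hmp.measurable.aemeasurable (by rw [hmp.map_eq]; exact (hf i).1)
    rw [hmp.map_eq] at this
    exact this.symm
  have h1 := variance_sum_pi (μ := fun _ : Fin n => ν) (X := f) hf
  have h2 : MemLp (∑ i, fun ω : Fin n → Ω => f i (ω i)) 2 (Measure.pi fun _ : Fin n => ν) :=
    memLp_finsetSum' _ fun i _ => hf' i
  have h3 := ofReal_variance h2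
  rw [evariance_eq_lintegral_ofReal, hm] at h3
  simp only [Finset.sum_apply] at h3
  rw [← h3, h1, ENNReal.ofReal_sum_of_nonneg (fun i _ => variance_nonneg _ _)]
  refine Finset.sum_le_sum fun i _ => ?_
  rw [← ofReal_integral_eq_lintegral_ofReal (hf i).integrable_sq (ae_of_all _ fun x => sq_nonneg _)]
  exact ENNReal.ofReal_le_ofReal (variance_le_expectation_sq (hf i).1)

section sph
variable {d : ℕ} (hd : 1 ≤ d) (μ : Measure (EuclideanSpace ℝ (Fin d))) [IsProbabilityMeasure μ]
  (hs : ∀ᵐ c ∂μ, ‖c‖ = 1)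
  (hinv : ∀ O : EuclideanSpace ℝ (Fin d) ≃ₗᵢ[ℝ] EuclideanSpace ℝ (Fin d), μ.map O = μ)
include hinv

lemma sph_rot (u v : EuclideanSpace ℝ (Fin d)) (h : ‖u‖ = ‖v‖) :
    ∫⁻ c, ENNReal.ofReal (⟪c, u⟫_ℝ ^ 2) ∂μ = ∫⁻ c, ENNReal.ofReal (⟪c, v⟫_ℝ ^ 2) ∂μ := by
  set O := Submodule.reflection (ℝ ∙ (u - v))ᗮ with hO
  have hOu : O u = v := Submodule.reflection_sub h
  conv_rhs => rw [← hinv O]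
  rw [lintegral_map (by fun_prop) (by fun_prop)]
  simp_rw [← hOu, LinearIsometryEquiv.inner_map_map]

include hs hd
lemma sph_sq (z : EuclideanSpace ℝ (Fin d)) :
    ∫⁻ c, ENNReal.ofReal (⟪c, z⟫_ℝ ^ 2) ∂μ = ENNReal.ofReal (‖z‖ ^ 2 / d) := by
  have h1 : ∀ i : Fin d, ∫⁻ c, ENNReal.ofReal (⟪c, z⟫_ℝ ^ 2) ∂μ =
      ∫⁻ c, ENNReal.ofReal (⟪c, ‖z‖ • EuclideanSpace.basisFun (Fin d) ℝ i⟫_ℝ ^ 2) ∂μ := by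
    intro i
    apply sph_rot μ hinv
    simp [norm_smul]
  have h2 : ∑ i : Fin d, ∫⁻ c, ENNReal.ofReal (⟪c, ‖z‖ • EuclideanSpace.basisFun (Fin d) ℝ i⟫_ℝ ^ 2) ∂μ
      = ENNReal.ofReal (‖z‖ ^ 2) := by
    rw [← lintegral_finsetSum _ (by fun_prop)]
    have : ∫⁻ c, ENNReal.ofReal (‖z‖ ^ 2) ∂μ = ENNReal.ofReal (‖z‖ ^ 2) := by simp
    rw [← this]
    refine lintegral_congr_ae ?_
    filter_upwards [hs] with c hc
    rw [← ENNReal.ofReal_sum_of_nonneg (fun i _ => sq_nonneg _)]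
    simp_rw [inner_smul_right, mul_pow, ← Finset.mul_sum]
    rw [OrthonormalBasis.sum_sq_inner_left, hc]
    simp
  simp_rw [← h1] at h2
  simp only [Finset.sum_const, Finset.card_univ, Fintype.card_fin, nsmul_eq_mul] at h2
  have hd' : (0:ℝ) < d := by exact_mod_cast hd
  rw [ENNReal.ofReal_div_of_pos hd', ← h2, ENNReal.ofReal_natCast, mul_comm]
  rw [ENNReal.mul_div_cancel_right (by simp; omega) (by simp)]

lemma sph_bdd (z : EuclideanSpace ℝ (Fin d)) : ∀ᵐ c ∂μ, |⟪c, z⟫_ℝ| ≤ ‖z‖ := by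
  filter_upwards [hs] with c hc
  simpa [hc] using abs_real_inner_le_norm c z

lemma sph_mean (z : EuclideanSpace ℝ (Fin d)) : ∫ c, ⟪c, z⟫_ℝ ∂μ = 0 := by
  have h : ∫ c, ⟪c, z⟫_ℝ ∂μ = - ∫ c, ⟪c, z⟫_ℝ ∂μ := by
    conv_lhs => rw [← hinv (LinearIsometryEquiv.neg ℝ)]
    rw [integral_map (by fun_prop) (by fun_prop)]
    simp [integral_neg]
  linarith

lemma sph_sq' (z : EuclideanSpace ℝ (Fin d)) :
    ∫ c, ⟪c, z⟫_ℝ ^ 2 ∂μ = ‖z‖ ^ 2 / d := by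
  rw [integral_eq_lintegral_of_nonneg_ae (ae_of_all _ fun x => sq_nonneg _) (by fun_prop),
    sph_sq hd μ hs hinv, ENNReal.toReal_ofReal (by positivity)]

/-- coordinate sums -/
lemma sph_S (n : ℕ) (s : Finset (Fin n)) :
    ∫⁻ c, ENNReal.ofReal (‖∑ i ∈ s, c i‖ ^ 2) ∂(Measure.pi fun _ : Fin n => μ) ≤ (n : ℝ≥0∞) := by
  have h1 : ∀ l : Fin d, ∫⁻ c, ENNReal.ofReal (⟪∑ i ∈ s, c i, EuclideanSpace.basisFun (Fin d) ℝ l⟫_ℝ ^ 2)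
      ∂(Measure.pi fun _ : Fin n => μ) ≤ n * ENNReal.ofReal (1 / d) := by
    intro l
    set e := EuclideanSpace.basisFun (Fin d) ℝ l
    have he : ‖e‖ = 1 := by simp [e]
    have hc : ∀ i : Fin n, MemLp (fun c => if i ∈ s then ⟪c, e⟫_ℝ else 0) 2 μ := by
      intro i
      split_ifs
      · exact MemLp.of_bound (by fun_prop) 1 (by simpa [he] using sph_bdd hd μ hs hinv e)
      · simp
    have h := lint_var_pi μ n (fun i c => if i ∈ s then ⟪c, e⟫_ℝ else 0) hc
    have hz : ∀ i, ∫ c, (if i ∈ s then ⟪c, e⟫_ℝ else 0) ∂μ = 0 := by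
      intro i
      split_ifs
      · exact sph_mean hd μ hs hinv e
      · simp
    simp only [hz, Finset.sum_const_zero, sub_zero] at h
    have hL : ∀ c : Fin n → EuclideanSpace ℝ (Fin d), ∑ i, (if i ∈ s then ⟪c i, e⟫_ℝ else 0) = ⟪∑ i ∈ s, c i, e⟫_ℝ := by
      intro c
      rw [sum_inner, Finset.sum_ite_mem, Finset.univ_inter]
    simp only [hL] at h
    refine h.trans ?_
    have : ∀ i ∈ (Finset.univ : Finset (Fin n)), ∫⁻ c, ENNReal.ofReal ((if i ∈ s then ⟪c, e⟫_ℝ else 0) ^ 2) ∂μ ≤ ENNReal.ofReal (1 / d) := by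
      intro i _
      split_ifs
      · rw [sph_sq hd μ hs hinv e, he]; simp
      · simp
    refine (Finset.sum_le_sum this).trans ?_
    simp
  have h2 : ∀ v : EuclideanSpace ℝ (Fin d), ENNReal.ofReal (‖v‖ ^ 2) =
      ∑ l, ENNReal.ofReal (⟪v, EuclideanSpace.basisFun (Fin d) ℝ l⟫_ℝ ^ 2) := by
    intro v
    rw [← ENNReal.ofReal_sum_of_nonneg (fun i _ => sq_nonneg _), OrthonormalBasis.sum_sq_inner_left]
  simp_rw [h2]
  rw [lintegral_finsetSum _ (by fun_prop)]
  refine (Finset.sum_le_sum fun l _ => h1 l).trans ?_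
  simp only [Finset.sum_const, Finset.card_univ, Fintype.card_fin, nsmul_eq_mul]
  have hd' : (0:ℝ) < d := by exact_mod_cast hd
  rw [ENNReal.ofReal_div_of_pos hd', ENNReal.ofReal_natCast, mul_left_comm]
  rw [ENNReal.mul_div_cancel (by simp; omega) (by simp)]
  simp

lemma sph_A (n : ℕ) (z : EuclideanSpace ℝ (Fin d)) :
    ∫⁻ c, ENNReal.ofReal ((∑ i, ⟪c i, z⟫_ℝ ^ 2 - n * (‖z‖ ^ 2 / d)) ^ 2) ∂(Measure.pi fun _ : Fin n => μ)
      ≤ n * ∫⁻ c, ENNReal.ofReal (⟪c, z⟫_ℝ ^ 4) ∂μ := by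
  have hc : ∀ i : Fin n, MemLp (fun c => ⟪c, z⟫_ℝ ^ 2) 2 μ := by
    intro i
    refine MemLp.of_bound (by fun_prop) (‖z‖ ^ 2) ?_
    filter_upwards [sph_bdd hd μ hs hinv z] with c hc
    rw [norm_pow]
    exact pow_le_pow_left₀ (norm_nonneg _) hc 2
  have h := lint_var_pi μ n (fun i c => ⟪c, z⟫_ℝ ^ 2) hc
  simp only [sph_sq' hd μ hs hinv z] at h
  simpa [← pow_mul] using h

/-- cross terms -/
lemma sph_B (n : ℕ) (X : EuclideanSpace ℝ (Fin d)) (i : Fin n) :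
    ∫⁻ c, ENNReal.ofReal (⟪c i, X + ∑ j ∈ Finset.univ.erase i, c j⟫_ℝ ^ 2)
      ∂(Measure.pi fun _ : Fin n => μ) ≤ ENNReal.ofReal ((2 * ‖X‖ ^ 2 + 2 * n) / d) := by
  have hI : iIndepFun (fun (i : Fin n) (c : Fin n → EuclideanSpace ℝ (Fin d)) => c i)
      (Measure.pi fun _ : Fin n => μ) :=
    iIndepFun_pi (X := fun _ x => x) (fun i => by fun_prop)
  have hI2 := (hI.indepFun_finsetSum_of_notMem (fun i => by fun_prop)
    (Finset.notMem_erase i Finset.univ)).symm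
  have hmap := (indepFun_iff_map_prod_eq_prod_map_map (measurable_pi_apply i).aemeasurable
    (Finset.aemeasurable_sum _ (fun j _ => (measurable_pi_apply j).aemeasurable))).1 hI2
  have hev : Measure.map (fun c : Fin n → EuclideanSpace ℝ (Fin d) => c i) (Measure.pi fun _ : Fin n => μ) = μ :=
    (measurePreserving_eval (fun _ : Fin n => μ) i).map_eq
  rw [hev] at hmap
  set T : (Fin n → EuclideanSpace ℝ (Fin d)) → EuclideanSpace ℝ (Fin d) :=
    ∑ j ∈ Finset.univ.erase i, fun c => c j with hT
  have hTm : Measurable T := by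
    have : T = fun c => ∑ j ∈ Finset.univ.erase i, c j := by
      ext c; simp [hT]
    rw [this]; fun_prop
  have e1 : ∫⁻ c, ENNReal.ofReal (⟪c i, X + ∑ j ∈ Finset.univ.erase i, c j⟫_ℝ ^ 2)
      ∂(Measure.pi fun _ : Fin n => μ) = ∫⁻ p, ENNReal.ofReal (⟪p.1, X + p.2⟫_ℝ ^ 2)
        ∂(Measure.map (fun ω => (ω i, T ω)) (Measure.pi fun _ : Fin n => μ)) := by
    rw [lintegral_map (by fun_prop) (by fun_prop)]
    simp [hT, Finset.sum_apply]
  have : IsProbabilityMeasure (Measure.map T (Measure.pi fun _ : Fin n => μ)) :=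
    Measure.isProbabilityMeasure_map hTm.aemeasurable
  rw [e1, hmap, lintegral_prod_symm _ (by fun_prop)]
  simp only [sph_sq hd μ hs hinv]
  rw [lintegral_map (by fun_prop) hTm]
  have hd' : (0:ℝ) < d := by exact_mod_cast hd
  have h3 : ∀ c, ENNReal.ofReal (‖X + T c‖ ^ 2 / d) ≤ ENNReal.ofReal (2 * ‖X‖ ^ 2 / d)
      + ENNReal.ofReal (2 / d) * ENNReal.ofReal (‖∑ j ∈ Finset.univ.erase i, c j‖ ^ 2) := by
    intro c
    rw [← ENNReal.ofReal_mul (by positivity), ← ENNReal.ofReal_add (by positivity) (by positivity)]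
    apply ENNReal.ofReal_le_ofReal
    have : T c = ∑ j ∈ Finset.univ.erase i, c j := by simp [hT]
    rw [this, ← mul_div_right_comm, ← add_div]
    gcongr
    have := norm_add_le X (∑ j ∈ Finset.univ.erase i, c j)
    nlinarith [sq_nonneg (‖X‖ - ‖∑ j ∈ Finset.univ.erase i, c j‖), norm_nonneg (X + ∑ j ∈ Finset.univ.erase i, c j)]
  refine (lintegral_mono h3).trans ?_
  rw [lintegral_add_left (by fun_prop), lintegral_const_mul _ (by fun_prop)]
  simp only [lintegral_const, measure_univ, mul_one]
  rw [add_div, ENNReal.ofReal_add (by positivity) (by positivity)]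
  gcongr
  refine (mul_le_mul_right (sph_S hd μ hs hinv n _) _).trans ?_
  rw [← ENNReal.ofReal_natCast, ← ENNReal.ofReal_mul (by positivity)]
  apply le_of_eq; congr 1; ring
end sph

lemma stdGaussianE_eq (d : ℕ) : stdGaussianE d = stdGaussian (EuclideanSpace ℝ (Fin d)) := by
  rw [← map_pi_eq_stdGaussian]; rfl

instance (d : ℕ) : IsProbabilityMeasure (stdGaussianE d) := by
  rw [stdGaussianE_eq]; infer_instance

noncomputable def gM : ℝ := ∫ x, x ^ 4 ∂(gaussianReal 0 1)

lemma memLp_sq_gauss : MemLp (fun x : ℝ => x ^ 2) 2 (gaussianReal 0 1) := by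
  have h : MemLp id 4 (gaussianReal 0 1) := memLp_id_gaussianReal 4
  have := (memLp_two_iff_integrable_sq (μ := gaussianReal 0 1) (f := fun x : ℝ => x ^ 2)
    (by fun_prop)).2
  apply this
  have h2 := h.integrable_norm_pow (p := 4) (by norm_num)
  simpa [← pow_mul, Even.pow_abs (show Even 4 by decide)] using h2

lemma gM_eq : ∫⁻ x, ENNReal.ofReal (x ^ 4) ∂(gaussianReal 0 1) = ENNReal.ofReal gM := by
  rw [gM, ofReal_integral_eq_lintegral_ofReal]
  · have := memLp_sq_gauss.integrable_sq
    simpa [← pow_mul] using this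
  · exact ae_of_all _ fun x => by positivity

lemma gM_nonneg : 0 ≤ gM := integral_nonneg fun x => by positivity

lemma gauss_map {d : ℕ} (u : EuclideanSpace ℝ (Fin d)) :
    (stdGaussianE d).map (fun z => ⟪u, z⟫_ℝ) = gaussianReal 0 (‖u‖ ^ 2).toNNReal := by
  rw [stdGaussianE_eq]
  have h := IsGaussian.map_eq_gaussianReal (μ := stdGaussian (EuclideanSpace ℝ (Fin d))) (innerSL ℝ u)
  rw [variance_dual_stdGaussian, integral_strongDual_stdGaussian, innerSL_apply_norm] at h
  exact h

lemma gauss_2 {d : ℕ} (u : EuclideanSpace ℝ (Fin d)) :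
    ∫⁻ z, ENNReal.ofReal (⟪u, z⟫_ℝ ^ 2) ∂(stdGaussianE d) = ENNReal.ofReal (‖u‖ ^ 2) := by
  have h := lintegral_map (μ := stdGaussianE d) (f := fun x : ℝ => ENNReal.ofReal (x ^ 2))
    (g := fun z => ⟪u, z⟫_ℝ) (by fun_prop) (by fun_prop)
  rw [← h, gauss_map]
  have h2 : MemLp id 2 (gaussianReal 0 (‖u‖ ^ 2).toNNReal) := memLp_id_gaussianReal 2
  have h3 := ofReal_variance h2
  rw [evariance_eq_lintegral_ofReal, variance_id_gaussianReal] at h3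
  simp only [id, integral_id_gaussianReal, sub_zero] at h3
  rw [← h3, Real.coe_toNNReal _ (by positivity)]

lemma gauss_4 {d : ℕ} (u : EuclideanSpace ℝ (Fin d)) (hu : ‖u‖ = 1) :
    ∫⁻ z, ENNReal.ofReal (⟪u, z⟫_ℝ ^ 4) ∂(stdGaussianE d) = ENNReal.ofReal gM := by
  have h := lintegral_map (μ := stdGaussianE d) (f := fun x : ℝ => ENNReal.ofReal (x ^ 4))
    (g := fun z => ⟪u, z⟫_ℝ) (by fun_prop) (by fun_prop)
  rw [← h, gauss_map, hu, ← gM_eq]; simp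

lemma gauss_Q (d : ℕ) :
    ∫⁻ z, ENNReal.ofReal ((‖z‖ ^ 2 - d) ^ 2) ∂(stdGaussianE d) ≤ d * ENNReal.ofReal gM := by
  have h := lint_var_pi (gaussianReal 0 1) d (fun _ x => x ^ 2) (fun _ => memLp_sq_gauss)
  have h1 : ∫ x, x ^ 2 ∂(gaussianReal 0 1) = 1 := by
    have := variance_of_integral_eq_zero (μ := gaussianReal 0 1) (X := id) (by fun_prop) (by simp)
    rw [variance_id_gaussianReal] at this
    simpa using this.symm
  simp only [h1, ← pow_mul] at h
  norm_num at h
  rw [gM_eq] at h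
  rw [stdGaussianE, lintegral_map (by fun_prop) (by fun_prop)]
  simpa [EuclideanSpace.norm_sq_eq] using h

section can
variable {d : ℕ} (hd : 1 ≤ d) (μ : Measure (EuclideanSpace ℝ (Fin d))) [IsProbabilityMeasure μ]
  (hs : ∀ᵐ c ∂μ, ‖c‖ = 1)
  (hinv : ∀ O : EuclideanSpace ℝ (Fin d) ≃ₗᵢ[ℝ] EuclideanSpace ℝ (Fin d), μ.map O = μ)
  (n : ℕ) (hn : 1 ≤ n)

lemma can_fst (f : (Fin n → EuclideanSpace ℝ (Fin d)) → ℝ≥0∞) (hf : Measurable f) :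
    ∫⁻ ω, f ω.1 ∂(canaryP d n μ) = ∫⁻ c, f c ∂(Measure.pi fun _ : Fin n => μ) := by
  rw [canaryP, lintegral_prod _ (by fun_prop)]
  simp

include hd in
lemma can_Q : ∫⁻ ω, ENNReal.ofReal ((‖ω.2‖ ^ 2 / d - 1) ^ 2) ∂(canaryP d n μ)
    ≤ ENNReal.ofReal (gM / d) := by
  have hd' : (0:ℝ) < d := by exact_mod_cast hd
  rw [canaryP, lintegral_prod _ (by fun_prop)]
  simp only [lintegral_const, measure_univ, mul_one]
  have : ∀ z : EuclideanSpace ℝ (Fin d), ENNReal.ofReal ((‖z‖ ^ 2 / d - 1) ^ 2)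
      = ENNReal.ofReal (1 / d ^ 2) * ENNReal.ofReal ((‖z‖ ^ 2 - d) ^ 2) := by
    intro z
    rw [← ENNReal.ofReal_mul (by positivity)]
    congr 1; field_simp
  simp_rw [this]
  rw [lintegral_const_mul _ (by fun_prop)]
  refine (mul_le_mul_right (gauss_Q d) _).trans ?_
  rw [← ENNReal.ofReal_natCast, ← ENNReal.ofReal_mul (by positivity), ← ENNReal.ofReal_mul (by positivity)]
  apply le_of_eq; congr 1; field_simp

include hd hs hinv in
lemma can_R : ∫⁻ ω, ENNReal.ofReal (‖∑ i, ω.1 i‖ ^ 2 / d) ∂(canaryP d n μ)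
    ≤ ENNReal.ofReal (n / d) := by
  have hd' : (0:ℝ) < d := by exact_mod_cast hd
  rw [can_fst μ n (fun c => ENNReal.ofReal (‖∑ i, c i‖ ^ 2 / d)) (by fun_prop)]
  simp_rw [div_eq_inv_mul, ENNReal.ofReal_mul (inv_nonneg.2 hd'.le)]
  rw [lintegral_const_mul _ (by fun_prop), ENNReal.ofReal_natCast]
  exact mul_le_mul_right (sph_S hd μ hs hinv n _) _

include hd hs hinv hn in
lemma can_B (X : EuclideanSpace ℝ (Fin d)) :
    ∫⁻ ω, ENNReal.ofReal ((1 / n : ℝ) * ∑ i, ⟪ω.1 i, X + ∑ j ∈ Finset.univ.erase i, ω.1 j⟫_ℝ ^ 2)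
      ∂(canaryP d n μ) ≤ ENNReal.ofReal ((2 * ‖X‖ ^ 2 + 2 * n) / d) := by
  have hn' : (0:ℝ) < n := by exact_mod_cast hn
  rw [can_fst μ n (fun c => ENNReal.ofReal ((1 / n : ℝ) * ∑ i, ⟪c i, X + ∑ j ∈ Finset.univ.erase i, c j⟫_ℝ ^ 2)) (by fun_prop)]
  simp_rw [ENNReal.ofReal_mul (one_div_pos.2 hn').le, ENNReal.ofReal_sum_of_nonneg (fun i _ => sq_nonneg _)]
  rw [lintegral_const_mul _ (by fun_prop), lintegral_finsetSum _ (by fun_prop)]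
  refine (mul_le_mul_right (Finset.sum_le_sum fun i _ => sph_B hd μ hs hinv n X i) _).trans ?_
  simp only [Finset.sum_const, Finset.card_univ, Fintype.card_fin, nsmul_eq_mul]
  rw [← ENNReal.ofReal_natCast, ← ENNReal.ofReal_mul (by positivity), ← ENNReal.ofReal_mul (by positivity)]
  apply le_of_eq; congr 1; field_simp

include hd hs hinv hn in
lemma can_m :
    ∫⁻ ω, ENNReal.ofReal (((1 / n : ℝ) * ∑ i, ⟪ω.1 i, ω.2⟫_ℝ) ^ 2)
      ∂(canaryP d n μ) ≤ ENNReal.ofReal (1 / n) := by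
  have hn' : (0:ℝ) < n := by exact_mod_cast hn
  rw [canaryP, lintegral_prod _ (by fun_prop)]
  simp_rw [mul_pow, ← sum_inner, ENNReal.ofReal_mul (sq_nonneg (1 / (n:ℝ)))]
  have : ∀ c : Fin n → EuclideanSpace ℝ (Fin d), ∫⁻ z, ENNReal.ofReal ((1 / (n:ℝ)) ^ 2) *
      ENNReal.ofReal (⟪∑ i, c i, z⟫_ℝ ^ 2) ∂(stdGaussianE d) =
      ENNReal.ofReal ((1 / (n:ℝ)) ^ 2) * ENNReal.ofReal (‖∑ i, c i‖ ^ 2) := by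
    intro c
    rw [lintegral_const_mul _ (by fun_prop), gauss_2]
  simp_rw [this]
  rw [lintegral_const_mul _ (by fun_prop)]
  refine (mul_le_mul_right (sph_S hd μ hs hinv n _) _).trans ?_
  rw [← ENNReal.ofReal_natCast, ← ENNReal.ofReal_mul (by positivity)]
  apply le_of_eq; congr 1; field_simp

include hd hs hinv hn in
lemma can_A :
    ∫⁻ ω, ENNReal.ofReal (((1 / n : ℝ) * ∑ i, ⟪ω.1 i, ω.2⟫_ℝ ^ 2 - ‖ω.2‖ ^ 2 / d) ^ 2)
      ∂(canaryP d n μ) ≤ ENNReal.ofReal (gM / n) := by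
  have hn' : (0:ℝ) < n := by exact_mod_cast hn
  rw [canaryP, lintegral_prod_symm _ (by fun_prop)]
  have : ∀ (z : EuclideanSpace ℝ (Fin d)) (c : Fin n → EuclideanSpace ℝ (Fin d)),
      ENNReal.ofReal (((1 / n : ℝ) * ∑ i, ⟪c i, z⟫_ℝ ^ 2 - ‖z‖ ^ 2 / d) ^ 2) =
      ENNReal.ofReal (1 / n ^ 2) * ENNReal.ofReal ((∑ i, ⟪c i, z⟫_ℝ ^ 2 - n * (‖z‖ ^ 2 / d)) ^ 2) := by
    intro z c
    rw [← ENNReal.ofReal_mul (by positivity)]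
    congr 1; field_simp
  simp_rw [this]
  have h2 : ∀ z : EuclideanSpace ℝ (Fin d), ∫⁻ c, ENNReal.ofReal (1 / n ^ 2) *
      ENNReal.ofReal ((∑ i, ⟪c i, z⟫_ℝ ^ 2 - n * (‖z‖ ^ 2 / d)) ^ 2) ∂(Measure.pi fun _ : Fin n => μ)
      ≤ ENNReal.ofReal (1 / n ^ 2) * (n * ∫⁻ c, ENNReal.ofReal (⟪c, z⟫_ℝ ^ 4) ∂μ) := by
    intro z
    rw [lintegral_const_mul _ (by fun_prop)]
    exact mul_le_mul_right (sph_A hd μ hs hinv n z) _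
  refine (lintegral_mono h2).trans ?_
  have hm : Measurable fun p : EuclideanSpace ℝ (Fin d) × EuclideanSpace ℝ (Fin d) =>
    ENNReal.ofReal (⟪p.2, p.1⟫_ℝ ^ 4) := by fun_prop
  rw [lintegral_const_mul _ (hm.lintegral_prod_right'.const_mul _),
    lintegral_const_mul _ hm.lintegral_prod_right', lintegral_lintegral_swap hm.aemeasurable]
  have h3 : ∫⁻ c, ∫⁻ z, ENNReal.ofReal (⟪c, z⟫_ℝ ^ 4) ∂(stdGaussianE d) ∂μ = ENNReal.ofReal gM := by
    have : ∫⁻ c, ENNReal.ofReal gM ∂μ = ENNReal.ofReal gM := by simp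
    rw [← this]
    apply lintegral_congr_ae
    filter_upwards [hs] with c hc using gauss_4 c hc
  rw [h3, ← ENNReal.ofReal_natCast, ← ENNReal.ofReal_mul (by positivity), ← ENNReal.ofReal_mul (by positivity)]
  apply le_of_eq; congr 1; field_simp
end can

/-- filter of events with probability tending to one, on the disjoint union of the spaces -/
def pfil {Ω : ℕ → Type*} [∀ d, MeasurableSpace (Ω d)] (P : ∀ d, Measure (Ω d)) :
    Filter (Σ d, Ω d) where
  sets := {s | Tendsto (fun d => P d {ω | (⟨d, ω⟩ : Σ d, Ω d) ∉ s}) atTop (𝓝 0)}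
  univ_sets := by simp
  sets_of_superset := by
    intro s t hs hst
    refine tendsto_of_tendsto_of_tendsto_of_le_of_le tendsto_const_nhds hs (fun _ => zero_le)
      (fun d => measure_mono fun ω hω h => hω (hst h))
  inter_sets := by
    intro s t hs ht
    have h : Tendsto (fun d => P d {ω | (⟨d, ω⟩ : Σ d, Ω d) ∉ s} + P d {ω | (⟨d, ω⟩ : Σ d, Ω d) ∉ t})
        atTop (𝓝 0) := by simpa using Tendsto.add hs ht
    refine tendsto_of_tendsto_of_tendsto_of_le_of_le tendsto_const_nhds h (fun _ => zero_le)
      (fun d => (measure_mono ?_).trans (measure_union_le _ _))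
    intro ω hω
    by_contra hc
    simp only [Set.mem_union, Set.mem_ofPred_eq, not_or, not_not] at hc
    exact hω hc

lemma pfil_eventually {Ω : ℕ → Type*} [∀ d, MeasurableSpace (Ω d)] (P : ∀ d, Measure (Ω d))
    (p : (Σ d, Ω d) → Prop) :
    (∀ᶠ x in pfil P, p x) ↔ Tendsto (fun d => P d {ω | ¬ p ⟨d, ω⟩}) atTop (𝓝 0) := Iff.rfl

lemma pfil_markov {Ω : ℕ → Type*} [∀ d, MeasurableSpace (Ω d)] (P : ∀ d, Measure (Ω d))
    (F : ∀ d, Ω d → ℝ) (hm : ∀ d, Measurable (F d)) (h0 : ∀ d ω, 0 ≤ F d ω)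
    (u : ℕ → ℝ) (hu : Tendsto u atTop (𝓝 0))
    (h : ∀ᶠ d in atTop, ∫⁻ ω, ENNReal.ofReal (F d ω) ∂(P d) ≤ ENNReal.ofReal (u d)) :
    Tendsto (fun x : Σ d, Ω d => F x.1 x.2) (pfil P) (𝓝 0) := by
  rw [Metric.tendsto_nhds]
  intro ε hε
  rw [pfil_eventually]
  have hu' : Tendsto (fun d => ENNReal.ofReal (u d) / ENNReal.ofReal ε) atTop (𝓝 0) := by
    have h1 := ENNReal.tendsto_ofReal hu
    rw [ENNReal.ofReal_zero] at h1
    have := ENNReal.Tendsto.div_const (b := ENNReal.ofReal ε) h1 (Or.inr (by simpa using hε))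
    simpa using this
  refine tendsto_of_tendsto_of_tendsto_of_le_of_le' tendsto_const_nhds hu'
    (Eventually.of_forall fun _ => zero_le) ?_
  filter_upwards [h] with d hd
  have h1 := meas_ge_le_lintegral_div (μ := P d) (f := fun ω => ENNReal.ofReal (F d ω))
    ((hm d).ennreal_ofReal.aemeasurable) (ε := ENNReal.ofReal ε) (by simpa using hε) (by simp)
  refine (measure_mono ?_).trans (h1.trans (ENNReal.div_le_div_right hd _))
  intro ω hω
  simp only [Set.mem_ofPred_eq, dist_zero_right, Real.norm_eq_abs, not_lt, abs_of_nonneg (h0 d ω)] at hω ⊢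
  exact ENNReal.ofReal_le_ofReal hω

lemma tendsto_zero_of_sq {α : Type*} {l : Filter α} {f g : α → ℝ} (hg : Tendsto g l (𝓝 0))
    (h : ∀ x, f x ^ 2 ≤ g x) : Tendsto f l (𝓝 0) := by
  have h1 : Tendsto (fun x => Real.sqrt (g x)) l (𝓝 0) := by simpa using hg.sqrt
  exact squeeze_zero_norm (fun x => Real.abs_le_sqrt (h x)) h1

lemma avg_cs (n : ℕ) (f g : Fin n → ℝ) :
    ((1 / n : ℝ) * ∑ i, f i * g i) ^ 2 ≤ ((1 / n : ℝ) * ∑ i, f i ^ 2) * ((1 / n : ℝ) * ∑ i, g i ^ 2) := by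
  have := Finset.sum_mul_sq_le_sq_mul_sq Finset.univ f g
  have h2 : (0:ℝ) ≤ (1 / n : ℝ) ^ 2 := by positivity
  nlinarith [mul_le_mul_of_nonneg_left this h2]

lemma avg_cs' (n : ℕ) (g : Fin n → ℝ) :
    ((1 / n : ℝ) * ∑ i, g i) ^ 2 ≤ (1 / n : ℝ) * ∑ i, g i ^ 2 := by
  rcases Nat.eq_zero_or_pos n with rfl | hn
  · simp
  have := avg_cs n (fun _ => 1) g
  have hn' : (n : ℝ) ≠ 0 := by positivity
  simpa [hn'] using this

lemma avg_var (n : ℕ) (hn : 1 ≤ n) (h x : Fin n → ℝ) (hx : ∀ i, x i = 1 + h i) (r : ℝ) :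
    (1 / n : ℝ) * ∑ i, (x i / r - (1 / n : ℝ) * ∑ j, x j / r) ^ 2 =
      ((1 / n : ℝ) * ∑ i, h i ^ 2 - ((1 / n : ℝ) * ∑ i, h i) ^ 2) / r ^ 2 := by
  have hn' : (n : ℝ) ≠ 0 := by positivity
  have e : ∀ i, (x i / r - (1 / n : ℝ) * ∑ j, x j / r) ^ 2 =
      (h i ^ 2 - 2 * ((1 / n : ℝ) * ∑ j, h j) * h i + ((1 / n : ℝ) * ∑ j, h j) ^ 2) / r ^ 2 := by
    intro i
    rw [← Finset.sum_div]
    simp_rw [hx]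
    rw [Finset.sum_add_distrib]
    simp only [Finset.sum_const, Finset.card_univ, Fintype.card_fin, nsmul_eq_mul, mul_one]
    rw [mul_div_assoc', ← sub_div, div_pow]
    congr 1
    field_simp
    ring
  simp_rw [e]
  rw [← Finset.sum_div, Finset.sum_add_distrib, Finset.sum_sub_distrib, ← Finset.mul_sum]
  simp only [Finset.sum_const, Finset.card_univ, Fintype.card_fin, nsmul_eq_mul]
  field_simp
  ring

lemma sigma_identity (d n : ℕ) (hn : 1 ≤ n) (hd : 1 ≤ d) (X : EuclideanSpace ℝ (Fin d)) (σ : ℝ)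
    (ω : (Fin n → EuclideanSpace ℝ (Fin d)) × EuclideanSpace ℝ (Fin d))
    (hω : ∀ i, ‖ω.1 i‖ = 1) :
    (d : ℝ) * sigmaHatSq d n X σ ω =
    (σ ^ 2 * ((1 / n : ℝ) * ∑ i, ⟪ω.1 i, ω.2⟫_ℝ ^ 2)
      + 2 * σ * ((1 / n : ℝ) * ∑ i, ⟪ω.1 i, ω.2⟫_ℝ * ⟪ω.1 i, X + ∑ j ∈ Finset.univ.erase i, ω.1 j⟫_ℝ)
      + (1 / n : ℝ) * ∑ i, ⟪ω.1 i, X + ∑ j ∈ Finset.univ.erase i, ω.1 j⟫_ℝ ^ 2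
      - (σ * ((1 / n : ℝ) * ∑ i, ⟪ω.1 i, ω.2⟫_ℝ)
        + (1 / n : ℝ) * ∑ i, ⟪ω.1 i, X + ∑ j ∈ Finset.univ.erase i, ω.1 j⟫_ℝ) ^ 2)
    / (σ ^ 2 * (‖ω.2‖ ^ 2 / d) + 2 * σ * (⟪ω.2, X + ∑ i, ω.1 i⟫_ℝ / d) + ‖X + ∑ i, ω.1 i‖ ^ 2 / d) := by
  have hd' : (d : ℝ) ≠ 0 := by positivity
  set h : Fin n → ℝ := fun i => σ * ⟪ω.1 i, ω.2⟫_ℝ + ⟪ω.1 i, X + ∑ j ∈ Finset.univ.erase i, ω.1 j⟫_ℝ with hh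
  have hx : ∀ i, ⟪ω.1 i, rhoF d n X σ ω⟫_ℝ = 1 + h i := by
    intro i
    rw [rhoF, ← Finset.add_sum_erase Finset.univ ω.1 (Finset.mem_univ i)]
    simp only [hh, inner_add_right, inner_smul_right, real_inner_self_eq_norm_sq, hω i]
    ring
  have hv := avg_var n hn h _ hx ‖rhoF d n X σ ω‖
  have e1 : sigmaHatSq d n X σ ω = _ := hv
  have e2 : ‖rhoF d n X σ ω‖ ^ 2 = σ ^ 2 * ‖ω.2‖ ^ 2 + 2 * σ * ⟪ω.2, X + ∑ i, ω.1 i⟫_ℝ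
      + ‖X + ∑ i, ω.1 i‖ ^ 2 := by
    rw [rhoF, norm_add_sq_real, norm_smul, inner_smul_right, mul_pow, Real.norm_eq_abs, sq_abs,
      real_inner_comm]
    ring
  rw [e1, e2]
  have e3 : σ ^ 2 * (‖ω.2‖ ^ 2 / d) + 2 * σ * (⟪ω.2, X + ∑ i, ω.1 i⟫_ℝ / d) + ‖X + ∑ i, ω.1 i‖ ^ 2 / d
      = (σ ^ 2 * ‖ω.2‖ ^ 2 + 2 * σ * ⟪ω.2, X + ∑ i, ω.1 i⟫_ℝ + ‖X + ∑ i, ω.1 i‖ ^ 2) / d := by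
    ring
  rw [e3, div_div_eq_mul_div, mul_div_assoc', mul_comm]
  congr 2
  have e4 : ∑ i, h i ^ 2 = σ ^ 2 * ∑ i, ⟪ω.1 i, ω.2⟫_ℝ ^ 2
      + 2 * σ * ∑ i, ⟪ω.1 i, ω.2⟫_ℝ * ⟪ω.1 i, X + ∑ j ∈ Finset.univ.erase i, ω.1 j⟫_ℝ
      + ∑ i, ⟪ω.1 i, X + ∑ j ∈ Finset.univ.erase i, ω.1 j⟫_ℝ ^ 2 := by
    rw [Finset.mul_sum, Finset.mul_sum, ← Finset.sum_add_distrib, ← Finset.sum_add_distrib]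
    refine Finset.sum_congr rfl fun i _ => ?_
    simp only [hh]; ring
  have e5 : ∑ i, h i = σ * ∑ i, ⟪ω.1 i, ω.2⟫_ℝ
      + ∑ i, ⟪ω.1 i, X + ∑ j ∈ Finset.univ.erase i, ω.1 j⟫_ℝ := by
    rw [Finset.mul_sum, ← Finset.sum_add_distrib]
  rw [e4, e5]; ring

/-- Under the asymptotic one-shot random-canary setup, the rescaled
empirical variance of the canary cosines satisfies `d · σ̂_d² → 1` in probability as
`d → ∞`, where `σ̂_d² = (1/k) ∑ᵢ (g_{di} - μ̂_d)²` with `g_{di} = ⟪c_{di}, ρ_d⟫ / ‖ρ_d‖`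
and `μ̂_d = (1/k) ∑ᵢ g_{di}`. -/
theorem rescaled_empirical_variance_tendsto_in_probability
    (X : ∀ d : ℕ, EuclideanSpace ℝ (Fin d))
    (hX : (fun d : ℕ => ‖X d‖) =o[atTop] fun d : ℕ => Real.sqrt d)
    (k : ℕ → ℕ)
    (hk₁ : Tendsto (fun d : ℕ => (k d : ℝ)) atTop atTop)
    (hk₂ : Tendsto (fun d : ℕ => (k d : ℝ) / d) atTop (𝓝 0))
    (σ : ℝ) (hσ : 0 < σ)
    (μs : ∀ d : ℕ, Measure (EuclideanSpace ℝ (Fin d)))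
    (hprob : ∀ d, 1 ≤ d → IsProbabilityMeasure (μs d))
    (hsphere : ∀ d, 1 ≤ d → μs d (Metric.sphere (0 : EuclideanSpace ℝ (Fin d)) 1) = 1)
    (hinv : ∀ d, 1 ≤ d →
      ∀ O : EuclideanSpace ℝ (Fin d) ≃ₗᵢ[ℝ] EuclideanSpace ℝ (Fin d),
        (μs d).map O = μs d)
    :
    ∀ ε : ℝ, 0 < ε →
      Tendsto (fun d : ℕ =>
          canaryP d (k d) (μs d)
            {ω | ε ≤ |(d : ℝ) * sigmaHatSq d (k d) (X d) σ ω - 1|})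
        atTop (𝓝 0) := by
  have hd1 : ∀ᶠ d : ℕ in atTop, 1 ≤ d := eventually_ge_atTop 1
  have hk1 : ∀ᶠ d : ℕ in atTop, 1 ≤ k d := by
    filter_upwards [hk₁.eventually_ge_atTop 1] with d hd
    exact_mod_cast hd
  have hae : ∀ d, 1 ≤ d → ∀ᵐ c ∂(μs d), ‖c‖ = 1 := by
    intro d hd
    have := hprob d hd
    have h := (prob_compl_eq_zero_iff (μ := μs d) Metric.isClosed_sphere.measurableSet).2 (hsphere d hd)
    rw [ae_iff]
    refine measure_mono_null ?_ h
    intro c hc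
    simpa using hc
  have hu1 : Tendsto (fun d => gM / (k d : ℝ)) atTop (𝓝 0) := hk₁.const_div_atTop _
  have hu2 : Tendsto (fun d : ℕ => gM / (d : ℝ)) atTop (𝓝 0) :=
    tendsto_natCast_atTop_atTop.const_div_atTop _
  have hu3 : Tendsto (fun d => 1 / (k d : ℝ)) atTop (𝓝 0) := hk₁.const_div_atTop _
  have hXd : Tendsto (fun d : ℕ => ‖X d‖ ^ 2 / d) atTop (𝓝 0) := by
    have h := (hX.tendsto_div_nhds_zero).pow 2
    simpa [div_pow] using h
  have hu4 : Tendsto (fun d : ℕ => (2 * ‖X d‖ ^ 2 + 2 * (k d : ℝ)) / d) atTop (𝓝 0) := by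
    have := (hXd.const_mul 2).add (hk₂.const_mul 2)
    simp only [mul_zero, add_zero] at this
    refine this.congr fun d => ?_
    ring
  set P := fun d => canaryP d (k d) (μs d) with hP
  -- the basic quantities
  have tA := pfil_markov P (fun d ω => ((1 / k d : ℝ) * ∑ i, ⟪ω.1 i, ω.2⟫_ℝ ^ 2 - ‖ω.2‖ ^ 2 / d) ^ 2)
    (fun d => by fun_prop) (fun d ω => sq_nonneg _) _ hu1 (by
      filter_upwards [hd1, hk1] with d hd hk
      have := hprob d hd
      exact can_A hd (μs d) (hae d hd) (hinv d hd) (k d) hk)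
  have tQ := pfil_markov P (fun d ω => (‖ω.2‖ ^ 2 / d - 1) ^ 2)
    (fun d => by fun_prop) (fun d ω => sq_nonneg _) _ hu2 (by
      filter_upwards [hd1, hk1] with d hd hk
      have := hprob d hd
      exact can_Q hd (μs d) (k d))
  have tm := pfil_markov P (fun d ω => ((1 / k d : ℝ) * ∑ i, ⟪ω.1 i, ω.2⟫_ℝ) ^ 2)
    (fun d => by fun_prop) (fun d ω => sq_nonneg _) _ hu3 (by
      filter_upwards [hd1, hk1] with d hd hk
      have := hprob d hd
      exact can_m hd (μs d) (hae d hd) (hinv d hd) (k d) hk)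
  have tB := pfil_markov P (fun d ω => (1 / k d : ℝ) *
      ∑ i, ⟪ω.1 i, X d + ∑ j ∈ Finset.univ.erase i, ω.1 j⟫_ℝ ^ 2)
    (fun d => by fun_prop) (fun d ω => by positivity) _ hu4 (by
      filter_upwards [hd1, hk1] with d hd hk
      have := hprob d hd
      exact can_B hd (μs d) (hae d hd) (hinv d hd) (k d) hk (X d))
  have tS := pfil_markov P (fun d ω => ‖∑ i, ω.1 i‖ ^ 2 / d)
    (fun d => by fun_prop) (fun d ω => by positivity) _ hk₂ (by
      filter_upwards [hd1, hk1] with d hd hk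
      have := hprob d hd
      exact can_R hd (μs d) (hae d hd) (hinv d hd) (k d))
  have hfst : Tendsto (fun x : Σ d, ((Fin (k d) → EuclideanSpace ℝ (Fin d)) × EuclideanSpace ℝ (Fin d)) => x.1)
      (pfil P) atTop := by
    rw [tendsto_atTop]
    intro N
    rw [pfil_eventually]
    refine tendsto_const_nhds.congr' ?_
    filter_upwards [eventually_ge_atTop N] with d hd
    simp [hd]
  have tX := hXd.comp hfst
  have hnorm : ∀ᶠ x in pfil P, ∀ i, ‖x.2.1 i‖ = 1 := by
    rw [pfil_eventually]
    refine tendsto_const_nhds.congr' ?_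
    filter_upwards [hd1] with d hd
    have := hprob d hd
    symm
    have h1 : ∀ᵐ c ∂(Measure.pi fun _ : Fin (k d) => μs d), ∀ i, ‖c i‖ = 1 := by
      rw [ae_all_iff]
      intro i
      exact (measurePreserving_eval (fun _ : Fin (k d) => μs d) i).quasiMeasurePreserving.ae (hae d hd)
    have h2 : ∀ᵐ ω ∂(P d), ∀ i, ‖ω.1 i‖ = 1 :=
      Measure.quasiMeasurePreserving_fst.ae h1
    exact ae_iff.1 h2
  -- derived limits
  have tQ' : Tendsto (fun x : Σ d, ((Fin (k d) → EuclideanSpace ℝ (Fin d)) × EuclideanSpace ℝ (Fin d)) =>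
      ‖x.2.2‖ ^ 2 / (x.1 : ℝ)) (pfil P) (𝓝 1) := by
    have := (tendsto_zero_of_sq tQ (fun x => le_rfl)).add_const 1
    simpa using this
  have tA' : Tendsto (fun x : Σ d, ((Fin (k d) → EuclideanSpace ℝ (Fin d)) × EuclideanSpace ℝ (Fin d)) =>
      (1 / k x.1 : ℝ) * ∑ i, ⟪x.2.1 i, x.2.2⟫_ℝ ^ 2) (pfil P) (𝓝 1) := by
    have := (tendsto_zero_of_sq tA (fun x => le_rfl)).add tQ'
    simpa using this
  have tm' := tendsto_zero_of_sq tm (fun x => le_rfl)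
  have tR : Tendsto (fun x : Σ d, ((Fin (k d) → EuclideanSpace ℝ (Fin d)) × EuclideanSpace ℝ (Fin d)) =>
      ‖X x.1 + ∑ i, x.2.1 i‖ ^ 2 / (x.1 : ℝ)) (pfil P) (𝓝 0) := by
    have h := (tX.const_mul 2).add (tS.const_mul 2)
    simp only [mul_zero, add_zero] at h
    refine squeeze_zero (fun x => by positivity) (fun x => ?_) h
    simp only [Function.comp_apply]
    rw [← mul_add, ← add_div, mul_div_assoc']
    gcongr
    have := norm_add_le (X x.1) (∑ i, x.2.1 i)
    nlinarith [sq_nonneg (‖X x.1‖ - ‖∑ i, x.2.1 i‖), norm_nonneg (X x.1 + ∑ i, x.2.1 i)]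
  have tC : Tendsto (fun x : Σ d, ((Fin (k d) → EuclideanSpace ℝ (Fin d)) × EuclideanSpace ℝ (Fin d)) =>
      (1 / k x.1 : ℝ) * ∑ i, ⟪x.2.1 i, x.2.2⟫_ℝ * ⟪x.2.1 i, X x.1 + ∑ j ∈ Finset.univ.erase i, x.2.1 j⟫_ℝ)
      (pfil P) (𝓝 0) := by
    have h := tA'.mul tB
    rw [mul_zero] at h
    exact tendsto_zero_of_sq h (fun x => avg_cs _ _ _)
  have tb : Tendsto (fun x : Σ d, ((Fin (k d) → EuclideanSpace ℝ (Fin d)) × EuclideanSpace ℝ (Fin d)) =>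
      (1 / k x.1 : ℝ) * ∑ i, ⟪x.2.1 i, X x.1 + ∑ j ∈ Finset.univ.erase i, x.2.1 j⟫_ℝ)
      (pfil P) (𝓝 0) :=
    tendsto_zero_of_sq tB (fun x => avg_cs' _ _)
  have tD : Tendsto (fun x : Σ d, ((Fin (k d) → EuclideanSpace ℝ (Fin d)) × EuclideanSpace ℝ (Fin d)) =>
      ⟪x.2.2, X x.1 + ∑ i, x.2.1 i⟫_ℝ / (x.1 : ℝ)) (pfil P) (𝓝 0) := by
    have h := tQ'.mul tR
    rw [mul_zero] at h
    refine tendsto_zero_of_sq h (fun x => ?_)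
    rw [div_mul_div_comm, div_pow, ← mul_pow, ← sq]
    gcongr 1
    rw [← sq_abs]
    exact pow_le_pow_left₀ (abs_nonneg _) (abs_real_inner_le_norm _ _) 2
  have hσ2 : σ ^ 2 * 1 + 2 * σ * 0 + 0 ≠ 0 := by
    have : σ ^ 2 ≠ 0 := by positivity
    simpa using this
  have tF := ((((tA'.const_mul (σ ^ 2)).add (tC.const_mul (2 * σ))).add tB).sub
    (((tm'.const_mul σ).add tb).pow 2)).div
    (((tQ'.const_mul (σ ^ 2)).add (tD.const_mul (2 * σ))).add tR) hσ2
  have tG : Tendsto (fun x : Σ d, ((Fin (k d) → EuclideanSpace ℝ (Fin d)) × EuclideanSpace ℝ (Fin d)) =>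
      (x.1 : ℝ) * sigmaHatSq x.1 (k x.1) (X x.1) σ x.2) (pfil P) (𝓝 1) := by
    have e : (σ ^ 2 * 1 + 2 * σ * 0 + 0 - (σ * 0 + 0) ^ 2) / (σ ^ 2 * 1 + 2 * σ * 0 + 0) = 1 := by
      field_simp
      ring
    rw [e] at tF
    refine tF.congr' ?_
    filter_upwards [hnorm, hfst.eventually hd1, hfst.eventually hk1] with x hx hxd hxk
    exact (sigma_identity x.1 (k x.1) hxk hxd (X x.1) σ x.2 hx).symm
  intro ε hε
  have := (Metric.tendsto_nhds.1 tG) ε hε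
  rw [pfil_eventually] at this
  simpa [Real.dist_eq, not_lt] using this
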